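/- arXiv:2309.07964 — 3 statements merged into one kernel-verified Lean document; each statement's English description precedes it below -/
import Mathlib

section
/- In the graph G_g, let x be an integer with 2^g ≤ x ≤ N and let F_1 ⊆ E_1 ∪ E_2 be a set of edges such that the path P_x = (1, 2, …, x) is a shortest 1–x path in G_g∖F_1. Then E_1 ⊆ F_1. -/
open SimpleGraph

/-- `E₁ = {{2^j, 2^(g+1) - 2^(j+2)} : 0 ≤ j ≤ g-3}`. -/
def E1 (g : ℕ) : Set (Sym2 ℕ) :=
  {e | ∃ j, j ≤ g - 3 ∧ e = s(2 ^ j, 2 ^ (g + 1) - 2 ^ (j + 2))}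

/-- `E₂ = {{2^(j+2), 2^(g+1) - 2^j} : 0 ≤ j ≤ g-3}`. -/
def E2 (g : ℕ) : Set (Sym2 ℕ) :=
  {e | ∃ j, j ≤ g - 3 ∧ e = s(2 ^ (j + 2), 2 ^ (g + 1) - 2 ^ j)}

/-- `E₃ = {{i, i+1} : 1 ≤ i ≤ N-1}` where `N = 2^(g+1) - 1`. -/
def E3 (g : ℕ) : Set (Sym2 ℕ) :=
  {e | ∃ i, 1 ≤ i ∧ i + 1 ≤ 2 ^ (g + 1) - 1 ∧ e = s(i, i + 1)}

/-- The graph `G_g` on vertices `{1, …, N}`, `N = 2^(g+1) - 1`, with edges `E₁ ∪ E₂ ∪ E₃`. -/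
def Gg (g : ℕ) : SimpleGraph ℕ := SimpleGraph.fromEdgeSet (E1 g ∪ E2 g ∪ E3 g)

/-- `supp` is the vertex list of a shortest `u`–`v` path in the graph `H`. -/
def IsShortestSupp (H : SimpleGraph ℕ) (u v : ℕ) (supp : List ℕ) : Prop :=
  ∃ p : H.Walk u v, p.support = supp ∧ p.IsPath ∧
    ∀ q : H.Walk u v, q.IsPath → p.length ≤ q.length

/-- segment walks -/
theorem seg_walk (H : SimpleGraph ℕ) (N : ℕ)
    (h : ∀ i, 1 ≤ i → i + 1 ≤ N → H.Adj i (i + 1)) (a : ℕ) (ha : 1 ≤ a) (d : ℕ)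
    (hd : a + d ≤ N) : ∃ q : H.Walk a (a + d), q.length = d := by
  induction d with
  | zero => exact ⟨Walk.nil, rfl⟩
  | succ d ih =>
    obtain ⟨q, hq⟩ := ih (by omega)
    refine ⟨q.concat (h (a + d) (by omega) (by omega)), ?_⟩
    simp [Walk.length_concat, hq]

/-- in `G_g` (`g ≥ 3`), if `2^g ≤ x ≤ N`, `F₁ ⊆ E₁ ∪ E₂`, and the path
`P_x = (1, 2, …, x)` (vertex list `List.range' 1 x`) is a shortest `1`–`x` path in
`G_g \ F₁`, then `E₁ ⊆ F₁`. -/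
theorem stmt_8 (g : ℕ) (hg : 3 ≤ g) (x : ℕ)
    (hx1 : 2 ^ g ≤ x) (hx2 : x ≤ 2 ^ (g + 1) - 1)
    (F1 : Set (Sym2 ℕ)) (hF1 : F1 ⊆ E1 g ∪ E2 g)
    (hshort : IsShortestSupp ((Gg g).deleteEdges F1) 1 x (List.range' 1 x)) :
    E1 g ⊆ F1 := by
  obtain ⟨p, hps, -, hmin⟩ := hshort
  have hplen : p.length + 1 = x := by
    rw [← Walk.length_support, hps, List.length_range']
  have hbig : ∀ j, j ≤ g - 3 → 1 ≤ 2 ^ j ∧ 8 * 2 ^ j ≤ 2 ^ g := by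
    intro j hj
    refine ⟨Nat.one_le_two_pow, ?_⟩
    have : 2 ^ (j + 3) ≤ 2 ^ g := Nat.pow_le_pow_right (by norm_num) (by omega)
    rw [pow_add] at this
    omega
  have hadj : ∀ i, 1 ≤ i → i + 1 ≤ 2 ^ (g + 1) - 1 →
      ((Gg g).deleteEdges F1).Adj i (i + 1) := by
    intro i h1 h2
    rw [SimpleGraph.deleteEdges_adj]
    constructor
    · rw [Gg, SimpleGraph.fromEdgeSet_adj]
      exact ⟨Or.inr ⟨i, h1, h2, rfl⟩, by omega⟩
    · intro hF
      rcases hF1 hF with ⟨j, hj, he⟩ | ⟨j, hj, he⟩ <;>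
      · have := hbig j hj
        rw [Sym2.eq_iff] at he
        simp only [pow_add, pow_one] at he
        omega
  rintro e ⟨j, hj, rfl⟩
  by_contra hF
  obtain ⟨hb1, hb2⟩ := hbig j hj
  have hE : ((Gg g).deleteEdges F1).Adj (2 ^ j) (2 ^ (g + 1) - 2 ^ (j + 2)) := by
    rw [SimpleGraph.deleteEdges_adj]
    refine ⟨?_, hF⟩
    rw [Gg, SimpleGraph.fromEdgeSet_adj]
    refine ⟨Or.inl (Or.inl ⟨j, hj, rfl⟩), ?_⟩
    simp only [pow_add, pow_one]
    omega
  have key : ∀ q : ((Gg g).deleteEdges F1).Walk 1 x, x ≤ q.length + 1 := by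
    intro q
    have h1 := hmin q.bypass q.bypass_isPath
    have h2 := q.length_bypass_le_length
    omega
  generalize hb : 2 ^ (g + 1) - 2 ^ (j + 2) = b at hE
  simp only [pow_add, pow_one] at hb
  have hN : 2 ^ (g + 1) = 2 ^ g * 2 := pow_succ 2 g
  have w1 : ∃ q : ((Gg g).deleteEdges F1).Walk 1 (2 ^ j), q.length = 2 ^ j - 1 := by
    have h := seg_walk _ _ hadj 1 le_rfl (2 ^ j - 1) (by omega)
    rwa [show 1 + (2 ^ j - 1) = 2 ^ j by omega] at h
  obtain ⟨q1, hq1⟩ := w1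
  rcases le_total b x with hbx | hbx
  · have h := seg_walk _ _ hadj b (by omega) (x - b) (by omega)
    rw [show b + (x - b) = x by omega] at h
    obtain ⟨q2, hq2⟩ := h
    have := key (q1.append (Walk.cons hE q2))
    rw [Walk.length_append, Walk.length_cons] at this
    omega
  · have h := seg_walk _ _ hadj x (by omega) (b - x) (by omega)
    rw [show x + (b - x) = b by omega] at h
    obtain ⟨q2, hq2⟩ := h
    have := key (q1.append (Walk.cons hE q2.reverse))
    rw [Walk.length_append, Walk.length_cons, Walk.length_reverse] at this
    omega
end

section
/- In the graph G_g, let x be an integer with 2^g ≤ x ≤ N and let F_1 ⊆ E_1 ∪ E_2 be a set of edges such that the path P_x = (1, 2, …, x) is a shortest 1–x path in G_g∖F_1. Then F_1 contains all but at most one of the edges of E_2; that is, |E_2 ∖ F_1| ≤ 1. -/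
open SimpleGraph

theorem aux_seg (g : ℕ) (hg : 3 ≤ g) (F1 : Set (Sym2 ℕ)) (hF1 : F1 ⊆ E1 g ∪ E2 g)
    (a : ℕ) (ha : 1 ≤ a) (d : ℕ) (hd : a + d ≤ 2 ^ (g + 1) - 1) :
    ∃ p : ((Gg g).deleteEdges F1).Walk a (a + d), p.length = d := by
  induction d with
  | zero => exact ⟨Walk.nil, rfl⟩
  | succ d ih =>
    obtain ⟨p, hp⟩ := ih (by omega)
    have hadj : ((Gg g).deleteEdges F1).Adj (a + d) (a + d + 1) := by
      rw [deleteEdges_adj, Gg, fromEdgeSet_adj]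
      refine ⟨⟨Or.inr ⟨a + d, by omega, by omega, rfl⟩, by omega⟩, fun h => ?_⟩
      obtain ⟨m, rfl⟩ := Nat.exists_eq_add_of_le' hg
      have hm := Nat.one_le_two_pow (n := m)
      rcases hF1 h with ⟨j, hj, h⟩ | ⟨j, hj, h⟩ <;>
      · have hj2 : 2 ^ j ≤ 2 ^ m := Nat.pow_le_pow_right (by norm_num) (by omega)
        have h1 := Nat.one_le_two_pow (n := j)
        rw [Sym2.eq_iff] at h
        simp only [pow_succ] at h
        omega
    exact ⟨p.concat hadj, by simp [Walk.length_concat, hp]⟩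

theorem aux_lt (g : ℕ) (hg : 3 ≤ g) (x : ℕ)
    (hx1 : 2 ^ g ≤ x) (hx2 : x ≤ 2 ^ (g + 1) - 1)
    (F1 : Set (Sym2 ℕ)) (hF1 : F1 ⊆ E1 g ∪ E2 g)
    (hshort : IsShortestSupp ((Gg g).deleteEdges F1) 1 x (List.range' 1 x))
    (j k : ℕ) (hjk : j < k) (hk : k ≤ g - 3)
    (h1 : s(2 ^ (j + 2), 2 ^ (g + 1) - 2 ^ j) ∉ F1)
    (h2 : s(2 ^ (k + 2), 2 ^ (g + 1) - 2 ^ k) ∉ F1) : False := by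
  obtain ⟨p, hp, -, hmin⟩ := hshort
  have hlen : p.length + 1 = x := by
    rw [← Walk.length_support, hp]; simp
  have hseg := aux_seg g hg F1 hF1
  have hmg : 2 ^ g = 8 * 2 ^ (g - 3) := by
    obtain ⟨m, rfl⟩ := Nat.exists_eq_add_of_le' hg
    simp [pow_succ]; omega
  have hkm : 2 ^ k ≤ 2 ^ (g - 3) := Nat.pow_le_pow_right (by norm_num) hk
  have hjk2 : 2 ^ (j + 1) ≤ 2 ^ k := Nat.pow_le_pow_right (by norm_num) hjk
  have hj1 := Nat.one_le_two_pow (n := j)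
  have e1 : 2 ^ (j + 2) = 4 * 2 ^ j := by rw [pow_add]; omega
  have e2 : 2 ^ (k + 2) = 4 * 2 ^ k := by rw [pow_add]; omega
  have e3 : 2 ^ (g + 1) = 2 * 2 ^ g := by rw [pow_succ]; omega
  have e4 : 2 ^ (j + 1) = 2 * 2 ^ j := by rw [pow_succ]; omega
  have a1 : ((Gg g).deleteEdges F1).Adj (2 ^ (j + 2)) (2 ^ (g + 1) - 2 ^ j) := by
    rw [deleteEdges_adj, Gg, fromEdgeSet_adj]
    exact ⟨⟨Or.inl (Or.inr ⟨j, by omega, rfl⟩), by omega⟩, h1⟩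
  have a2 : ((Gg g).deleteEdges F1).Adj (2 ^ (k + 2)) (2 ^ (g + 1) - 2 ^ k) := by
    rw [deleteEdges_adj, Gg, fromEdgeSet_adj]
    exact ⟨⟨Or.inl (Or.inr ⟨k, by omega, rfl⟩), by omega⟩, h2⟩
  obtain ⟨p1, hp1⟩ := hseg 1 le_rfl (2 ^ (j + 2) - 1) (by omega)
  obtain ⟨p2, hp2⟩ := hseg (2 ^ (g + 1) - 2 ^ k) (by omega) (2 ^ k - 2 ^ j) (by omega)
  obtain ⟨p3, hp3⟩ := hseg (2 ^ (k + 2)) (by omega) (x - 2 ^ (k + 2)) (by omega)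
  let q1 := p1.copy rfl (show 1 + (2 ^ (j + 2) - 1) = 2 ^ (j + 2) by omega)
  let q2 := p2.copy rfl
    (show 2 ^ (g + 1) - 2 ^ k + (2 ^ k - 2 ^ j) = 2 ^ (g + 1) - 2 ^ j by omega)
  let q3 := p3.copy rfl (show 2 ^ (k + 2) + (x - 2 ^ (k + 2)) = x by omega)
  let q := q1.append (Walk.cons a1 (q2.reverse.append (Walk.cons a2.symm q3)))
  have hq : q.length = (2 ^ (j + 2) - 1) + ((2 ^ k - 2 ^ j) + (x - 2 ^ (k + 2) + 1) + 1) := by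
    simp only [q, q1, q2, q3, Walk.length_append, Walk.length_cons, Walk.length_reverse,
      Walk.length_copy, hp1, hp2, hp3]
  have hb := hmin q.bypass q.bypass_isPath
  have hb2 := q.length_bypass_le
  omega

/-- in `G_g` (`g ≥ 3`), if `2^g ≤ x ≤ N`, `F₁ ⊆ E₁ ∪ E₂`, and the path
`P_x = (1, 2, …, x)` (vertex list `List.range' 1 x`) is a shortest `1`–`x` path in
`G_g \ F₁`, then `F₁` contains all but at most one edge of `E₂`, i.e. `E₂ \ F₁` has at most one element. -/
theorem stmt_9 (g : ℕ) (hg : 3 ≤ g) (x : ℕ)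
    (hx1 : 2 ^ g ≤ x) (hx2 : x ≤ 2 ^ (g + 1) - 1)
    (F1 : Set (Sym2 ℕ)) (hF1 : F1 ⊆ E1 g ∪ E2 g)
    (hshort : IsShortestSupp ((Gg g).deleteEdges F1) 1 x (List.range' 1 x)) :
    (E2 g \ F1).Subsingleton := by
  rintro e ⟨⟨j, hj, rfl⟩, h1⟩ f ⟨⟨k, hk, rfl⟩, h2⟩
  rcases lt_trichotomy j k with h | rfl | h
  · exact (aux_lt g hg x hx1 hx2 F1 hF1 hshort j k h hk h1 h2).elim
  · rfl
  · exact (aux_lt g hg x hx1 hx2 F1 hF1 hshort k j h hj h2 h1).elim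
end

section
/- In the graph G_g, let x be an integer with 2^g ≤ x ≤ N and let F_1 ⊆ E_1 ∪ E_2 be a set of edges such that the path P_x = (1, 2, …, x) is a shortest 1–x path in G_g∖F_1. Then |F_1| ≥ |E_1| + |E_2| − 1 = 2g − 5. -/
open SimpleGraph

theorem pow_facts (g j : ℕ) (hg : 3 ≤ g) (hj : j ≤ g - 3) :
    16 * 2 ^ j ≤ 2 ^ (g + 1) ∧ 1 ≤ 2 ^ j ∧ 2 ^ (j + 2) = 4 * 2 ^ j := by
  refine ⟨?_, Nat.one_le_two_pow, by ring⟩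
  calc 16 * 2 ^ j = 2 ^ (j + 4) := by ring
    _ ≤ 2 ^ (g + 1) := Nat.pow_le_pow_right (by norm_num) (by omega)

theorem E1_ncard (g : ℕ) (hg : 3 ≤ g) : (E1 g).ncard = g - 2 := by
  have : E1 g = (fun j => s(2 ^ j, 2 ^ (g + 1) - 2 ^ (j + 2))) '' (Finset.range (g - 2) : Set ℕ) := by
    ext e
    simp only [E1, Set.mem_setOf_eq, Set.mem_image, Finset.coe_range, Set.mem_Iio]
    constructor
    · rintro ⟨j, hj, rfl⟩; exact ⟨j, by omega, rfl⟩
    · rintro ⟨j, hj, rfl⟩; exact ⟨j, by omega, rfl⟩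
  rw [this, Set.InjOn.ncard_image, Set.ncard_coe_finset, Finset.card_range]
  intro j hj k hk h
  simp only [Finset.coe_range, Set.mem_Iio] at hj hk
  obtain ⟨a1, a2, a3⟩ := pow_facts g j hg (by omega)
  obtain ⟨b1, b2, b3⟩ := pow_facts g k hg (by omega)
  simp only [Sym2.eq_iff] at h
  apply Nat.pow_right_injective (le_refl 2)
  show 2 ^ j = 2 ^ k
  omega

theorem E2_ncard (g : ℕ) (hg : 3 ≤ g) : (E2 g).ncard = g - 2 := by
  have : E2 g = (fun j => s(2 ^ (j + 2), 2 ^ (g + 1) - 2 ^ j)) '' (Finset.range (g - 2) : Set ℕ) := by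
    ext e
    simp only [E2, Set.mem_setOf_eq, Set.mem_image, Finset.coe_range, Set.mem_Iio]
    constructor
    · rintro ⟨j, hj, rfl⟩; exact ⟨j, by omega, rfl⟩
    · rintro ⟨j, hj, rfl⟩; exact ⟨j, by omega, rfl⟩
  rw [this, Set.InjOn.ncard_image, Set.ncard_coe_finset, Finset.card_range]
  intro j hj k hk h
  simp only [Finset.coe_range, Set.mem_Iio] at hj hk
  obtain ⟨a1, a2, a3⟩ := pow_facts g j hg (by omega)
  obtain ⟨b1, b2, b3⟩ := pow_facts g k hg (by omega)
  simp only [Sym2.eq_iff] at h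
  apply Nat.pow_right_injective (le_refl 2)
  show 2 ^ j = 2 ^ k
  omega

theorem E_disj (g : ℕ) (hg : 3 ≤ g) : Disjoint (E1 g) (E2 g) := by
  rw [Set.disjoint_left]
  rintro e ⟨j, hj, rfl⟩ ⟨k, hk, h⟩
  obtain ⟨a1, a2, a3⟩ := pow_facts g j hg hj
  obtain ⟨b1, b2, b3⟩ := pow_facts g k hg hk
  simp only [Sym2.eq_iff] at h
  omega

theorem line_walk (g : ℕ) (hg : 3 ≤ g) (F1 : Set (Sym2 ℕ)) (hF1 : F1 ⊆ E1 g ∪ E2 g)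
    (a n : ℕ) (ha : 1 ≤ a) (hb : a + n ≤ 2 ^ (g + 1) - 1) :
    ∃ p : ((Gg g).deleteEdges F1).Walk a (a + n), p.length = n := by
  induction n with
  | zero => exact ⟨Walk.nil, rfl⟩
  | succ n ih =>
    obtain ⟨p, hp⟩ := ih (by omega)
    have hadj : ((Gg g).deleteEdges F1).Adj (a + n) (a + (n + 1)) := by
      rw [deleteEdges_adj]
      refine ⟨?_, fun hmem => ?_⟩
      · rw [Gg, fromEdgeSet_adj]
        exact ⟨Or.inr ⟨a + n, by omega, by omega, rfl⟩, by omega⟩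
      · rcases hF1 hmem with ⟨j, hj, h⟩ | ⟨j, hj, h⟩
        all_goals
          obtain ⟨a1, a2, a3⟩ := pow_facts g j hg hj
          simp only [Sym2.eq_iff] at h
          omega
    exact ⟨p.concat hadj, by rw [Walk.length_concat, hp]⟩

theorem seg_walk_s10 (g : ℕ) (hg : 3 ≤ g) (F1 : Set (Sym2 ℕ)) (hF1 : F1 ⊆ E1 g ∪ E2 g)
    (a b : ℕ) (ha : 1 ≤ a) (hb : 1 ≤ b) (ha' : a ≤ 2 ^ (g + 1) - 1) (hb' : b ≤ 2 ^ (g + 1) - 1) :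
    ∃ p : ((Gg g).deleteEdges F1).Walk a b, p.length = (a - b) + (b - a) := by
  rcases le_total a b with h | h
  · obtain ⟨n, rfl⟩ := Nat.exists_eq_add_of_le h
    obtain ⟨p, hp⟩ := line_walk g hg F1 hF1 a n ha hb'
    exact ⟨p, by omega⟩
  · obtain ⟨n, rfl⟩ := Nat.exists_eq_add_of_le h
    obtain ⟨p, hp⟩ := line_walk g hg F1 hF1 b n hb ha'
    exact ⟨p.reverse, by rw [Walk.length_reverse]; omega⟩

theorem E1_adj (g : ℕ) (hg : 3 ≤ g) (F1 : Set (Sym2 ℕ)) (j : ℕ) (hj : j ≤ g - 3)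
    (h : s(2 ^ j, 2 ^ (g + 1) - 2 ^ (j + 2)) ∉ F1) :
    ((Gg g).deleteEdges F1).Adj (2 ^ j) (2 ^ (g + 1) - 2 ^ (j + 2)) := by
  obtain ⟨a1, a2, a3⟩ := pow_facts g j hg hj
  rw [deleteEdges_adj, Gg, fromEdgeSet_adj]
  exact ⟨⟨Or.inl (Or.inl ⟨j, hj, rfl⟩), by omega⟩, h⟩

theorem E2_adj (g : ℕ) (hg : 3 ≤ g) (F1 : Set (Sym2 ℕ)) (j : ℕ) (hj : j ≤ g - 3)
    (h : s(2 ^ (j + 2), 2 ^ (g + 1) - 2 ^ j) ∉ F1) :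
    ((Gg g).deleteEdges F1).Adj (2 ^ (j + 2)) (2 ^ (g + 1) - 2 ^ j) := by
  obtain ⟨a1, a2, a3⟩ := pow_facts g j hg hj
  rw [deleteEdges_adj, Gg, fromEdgeSet_adj]
  exact ⟨⟨Or.inl (Or.inr ⟨j, hj, rfl⟩), by omega⟩, h⟩

/-- in `G_g` (`g ≥ 3`), if `2^g ≤ x ≤ N`, `F₁ ⊆ E₁ ∪ E₂`, and the path
`P_x = (1, 2, …, x)` (vertex list `List.range' 1 x`) is a shortest `1`–`x` path in
`G_g \ F₁`, then `|F₁| ≥ |E₁| + |E₂| - 1 = 2g - 5`. -/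
theorem stmt_10 (g : ℕ) (hg : 3 ≤ g) (x : ℕ)
    (hx1 : 2 ^ g ≤ x) (hx2 : x ≤ 2 ^ (g + 1) - 1)
    (F1 : Set (Sym2 ℕ)) (hF1 : F1 ⊆ E1 g ∪ E2 g)
    (hshort : IsShortestSupp ((Gg g).deleteEdges F1) 1 x (List.range' 1 x)) :
    (E1 g).ncard + (E2 g).ncard - 1 = 2 * g - 5 ∧ 2 * g - 5 ≤ F1.ncard := by
  have hc1 := E1_ncard g hg
  have hc2 := E2_ncard g hg
  refine ⟨by omega, ?_⟩
  have hgpow : 2 ^ (g + 1) = 2 * 2 ^ g := by ring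
  have hwalk : ∀ q : ((Gg g).deleteEdges F1).Walk 1 x, x ≤ q.length + 1 := by
    obtain ⟨p, hp, -, hmin⟩ := hshort
    intro q
    have h1 := hmin q.bypass q.bypass_isPath
    have h2 := q.length_bypass_le
    have h3 := p.length_support
    rw [hp, List.length_range'] at h3
    omega
  have hE1 : E1 g ⊆ F1 := by
    rintro e ⟨j, hj, rfl⟩
    by_contra hn
    have hadj := E1_adj g hg F1 j hj hn
    obtain ⟨a1, a2, a3⟩ := pow_facts g j hg hj
    obtain ⟨p, hp⟩ := seg_walk_s10 g hg F1 hF1 1 (2 ^ j) (by omega) (by omega) (by omega) (by omega)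
    obtain ⟨r, hr⟩ := seg_walk_s10 g hg F1 hF1 (2 ^ (g + 1) - 2 ^ (j + 2)) x
      (by omega) (by omega) (by omega) (by omega)
    have := hwalk (p.append (Walk.cons hadj r))
    rw [Walk.length_append, Walk.length_cons] at this
    omega
  have key : ∀ j k, j < k → k ≤ g - 3 → s(2 ^ (j + 2), 2 ^ (g + 1) - 2 ^ j) ∉ F1 →
      s(2 ^ (k + 2), 2 ^ (g + 1) - 2 ^ k) ∉ F1 → False := by
    intro j k hjk hk h1 h2
    have hadj := E2_adj g hg F1 j (by omega) h1
    have hadk := (E2_adj g hg F1 k hk h2).symm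
    obtain ⟨a1, a2, a3⟩ := pow_facts g j hg (by omega)
    obtain ⟨b1, b2, b3⟩ := pow_facts g k hg hk
    have hlt : 2 * 2 ^ j ≤ 2 ^ k := by
      calc 2 * 2 ^ j = 2 ^ (j + 1) := by ring
        _ ≤ 2 ^ k := Nat.pow_le_pow_right (by norm_num) hjk
    obtain ⟨p, hp⟩ := seg_walk_s10 g hg F1 hF1 1 (2 ^ (j + 2))
      (by omega) (by omega) (by omega) (by omega)
    obtain ⟨r, hr⟩ := seg_walk_s10 g hg F1 hF1 (2 ^ (g + 1) - 2 ^ j) (2 ^ (g + 1) - 2 ^ k)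
      (by omega) (by omega) (by omega) (by omega)
    obtain ⟨t, ht⟩ := seg_walk_s10 g hg F1 hF1 (2 ^ (k + 2)) x
      (by omega) (by omega) (by omega) (by omega)
    have := hwalk (p.append (Walk.cons hadj (r.append (Walk.cons hadk t))))
    rw [Walk.length_append, Walk.length_cons, Walk.length_append, Walk.length_cons] at this
    omega
  have hsub : ((E1 g ∪ E2 g) \ F1).Subsingleton := by
    rintro e ⟨he, he'⟩ f ⟨hf, hf'⟩
    rcases he with he | ⟨j, hj, rfl⟩
    · exact absurd (hE1 he) he'
    rcases hf with hf | ⟨k, hk, rfl⟩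
    · exact absurd (hE1 hf) hf'
    rcases lt_trichotomy j k with h | h | h
    · exact (key j k h hk he' hf').elim
    · rw [h]
    · exact (key k j h hj hf' he').elim
  have hfin1 : (E1 g).Finite := Set.finite_of_ncard_pos (by omega)
  have hfin2 : (E2 g).Finite := Set.finite_of_ncard_pos (by omega)
  have hfin : F1.Finite := (hfin1.union hfin2).subset hF1
  have hu := Set.ncard_union_eq (E_disj g hg) hfin1 hfin2
  have hd := Set.ncard_le_ncard_diff_add_ncard (E1 g ∪ E2 g) F1 hfin
  have h1 : ((E1 g ∪ E2 g) \ F1).ncard ≤ 1 :=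
    (Set.ncard_le_one ((hfin1.union hfin2).subset Set.diff_subset)).2
      (fun a ha b hb => hsub ha hb)
  omega
end
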